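/- Let D be connected and let L be a two-dimensional complex Finsler metric on D such that A and B are nowhere zero on D, δ_k I = 0 on D for all k, and ∂I/∂η^i = −(I/F)·l_i on D for all i. Then there exists a real constant c with I·L = c at every point of D; in particular I = c/L, so the vertical holomorphic sectional curvature in direction m equals 2c/L. -/

import Mathlib

open Complex

noncomputable section

namespace CFinsler

/-- A point of `T'M` in local coordinates: `(z, η) ∈ ℂⁿ × ℂⁿ`. -/
abbrev Pt (n : ℕ) := (Fin n → ℂ) × (Fin n → ℂ)

variable {n : ℕ}

/-- Wirtinger derivative `∂f/∂z^k`. -/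
def dz (f : Pt n → ℂ) (k : Fin n) (p : Pt n) : ℂ :=
  (1 / 2) * (fderiv ℝ f p ((Pi.single k 1 : Fin n → ℂ), 0) -
    Complex.I * fderiv ℝ f p ((Pi.single k Complex.I : Fin n → ℂ), 0))

/-- Wirtinger derivative `∂f/∂z̄^k`. -/
def dzbar (f : Pt n → ℂ) (k : Fin n) (p : Pt n) : ℂ :=
  (1 / 2) * (fderiv ℝ f p ((Pi.single k 1 : Fin n → ℂ), 0) +
    Complex.I * fderiv ℝ f p ((Pi.single k Complex.I : Fin n → ℂ), 0))

/-- Wirtinger derivative `∂f/∂η^k`. -/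
def de (f : Pt n → ℂ) (k : Fin n) (p : Pt n) : ℂ :=
  (1 / 2) * (fderiv ℝ f p (0, (Pi.single k 1 : Fin n → ℂ)) -
    Complex.I * fderiv ℝ f p (0, (Pi.single k Complex.I : Fin n → ℂ)))

/-- Wirtinger derivative `∂f/∂η̄^k`. -/
def debar (f : Pt n → ℂ) (k : Fin n) (p : Pt n) : ℂ :=
  (1 / 2) * (fderiv ℝ f p (0, (Pi.single k 1 : Fin n → ℂ)) +
    Complex.I * fderiv ℝ f p (0, (Pi.single k Complex.I : Fin n → ℂ)))

/-- The fundamental metric tensor `g_{i j̄} := ∂²L/∂η^i ∂η̄^j`. -/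
def gm (L : Pt n → ℂ) (i j : Fin n) : Pt n → ℂ := de (debar L j) i

/-- `L` is an `n`-dimensional complex Finsler metric on `D`. -/
structure IsCFM (n : ℕ) (D : Set (Pt n)) (L : Pt n → ℂ) : Prop where
  openD : IsOpen D
  fiber_ne : ∀ p ∈ D, p.2 ≠ 0
  conic : ∀ p ∈ D, ∀ lam : ℂ, lam ≠ 0 → (p.1, lam • p.2) ∈ D
  smooth : ContDiffOn ℝ (⊤ : ℕ∞) L D
  real_im : ∀ p ∈ D, (L p).im = 0
  pos : ∀ p ∈ D, 0 < (L p).re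
  homog : ∀ p ∈ D, ∀ lam : ℂ, lam ≠ 0 →
    L (p.1, lam • p.2) = ((Complex.normSq lam : ℝ) : ℂ) * L p
  hermitian : ∀ p ∈ D, ∀ i j, (starRingEnd ℂ) (gm L i j p) = gm L j i p
  posdef : ∀ p ∈ D, ∀ v : Fin n → ℂ, v ≠ 0 →
    0 < (∑ i, ∑ j, gm L i j p * v i * (starRingEnd ℂ) (v j)).re

variable (L : Pt n → ℂ)

/-- The metric tensor as a matrix at a point. -/
def gmat (p : Pt n) : Matrix (Fin n) (Fin n) ℂ := fun i j => gm L i j p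

/-- The inverse metric tensor `g^{l̄ i}`. -/
def gi (l i : Fin n) (p : Pt n) : ℂ := (gmat L p)⁻¹ l i

/-- The Chern–Finsler nonlinear connection coefficients
`N^i_k := g^{m̄ i} (∂g_{l m̄}/∂z^k) η^l`. -/
def Nc (i k : Fin n) (p : Pt n) : ℂ :=
  ∑ m, ∑ l, gi L m i p * dz (gm L l m) k p * p.2 l

/-- The horizontal derivation `δ_k := ∂/∂z^k − N^j_k ∂/∂η^j`. -/
def del (f : Pt n → ℂ) (k : Fin n) (p : Pt n) : ℂ :=
  dz f k p - ∑ j, Nc L j k p * de f j p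

/-- The conjugate horizontal derivation `δ_k̄ := ∂/∂z̄^k − N̄^j_k ∂/∂η̄^j`. -/
def delbar (f : Pt n → ℂ) (k : Fin n) (p : Pt n) : ℂ :=
  dzbar f k p - ∑ j, (starRingEnd ℂ) (Nc L j k p) * debar f j p

/-- The horizontal Chern–Finsler connection coefficients `L^i_{jk} := g^{l̄ i} δ_k(g_{j l̄})`. -/
def Lc (i j k : Fin n) (p : Pt n) : ℂ := ∑ l, gi L l i p * del L (gm L j l) k p

/-- The vertical Chern–Finsler connection coefficients `C^i_{jk} := g^{l̄ i} ∂g_{j l̄}/∂η^k`. -/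
def Cc (i j k : Fin n) (p : Pt n) : ℂ := ∑ l, gi L l i p * de (gm L j l) k p

/-- The spray coefficients `G^i := ½ N^i_j η^j`. -/
def Gs (i : Fin n) (p : Pt n) : ℂ := (1 / 2) * ∑ j, Nc L i j p * p.2 j

/-- The canonical horizontal derivation `δ̊_k := ∂/∂z^k − (∂G^j/∂η^k) ∂/∂η^j`. -/
def delc (f : Pt n → ℂ) (k : Fin n) (p : Pt n) : ℂ :=
  dz f k p - ∑ j, de (Gs L j) k p * de f j p

/-- `F := √L`. -/
def Fh (p : Pt n) : ℂ := (Real.sqrt ((L p).re) : ℂ)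

/-- `l^i := η^i / F`. -/
def lup (i : Fin n) (p : Pt n) : ℂ := p.2 i / Fh L p

/-- `l_i := g_{i j̄} η̄^j / F`. -/
def llow (i : Fin n) (p : Pt n) : ℂ :=
  (∑ j, gm L i j p * (starRingEnd ℂ) (p.2 j)) / Fh L p

/-- `√g` where `g := det(g_{i j̄})`. -/
def sg (p : Pt n) : ℂ := (Real.sqrt ((gmat L p).det.re) : ℂ)

/-- The metric is Kähler. -/
def IsKahler (D : Set (Pt n)) : Prop := ∀ p ∈ D, ∀ i j k, Lc L i j k p = Lc L i k j p

/-- The metric is weakly Kähler. -/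
def IsWeaklyKahler (D : Set (Pt n)) : Prop :=
  ∀ p ∈ D, ∀ k, (∑ i, ∑ j, ∑ l, gm L i l p * (Lc L i j k p - Lc L i k j p) *
    p.2 j * (starRingEnd ℂ) (p.2 l)) = 0

/-- The metric is purely Hermitian: `g_{i j̄}` does not depend on the fibre variable. -/
def IsPurelyHermitian (D : Set (Pt n)) : Prop :=
  ∀ p ∈ D, ∀ i j k, de (gm L i j) k p = 0 ∧ debar (gm L i j) k p = 0

/-- The metric is a complex Berwald metric: Kähler with `L^i_{jk}` independent of the
fibre variable. -/
def IsBerwald (D : Set (Pt n)) : Prop :=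
  IsKahler L D ∧ ∀ p ∈ D, ∀ i j k l, de (Lc L i j k) l p = 0 ∧ debar (Lc L i j k) l p = 0

/-- The metric is a complex Landsberg metric: the Berwald and Rund connections coincide. -/
def IsLandsberg (D : Set (Pt n)) : Prop :=
  ∀ p ∈ D, ∀ i j k, de (de (Gs L i) k) j p =
    (1 / 2) * ∑ l, gi L l i p * (delc L (gm L j l) k p + delc L (gm L k l) j p)

/-- `m^i` of the local complex Berwald frame: `m¹ = −l₂/√g`, `m² = l₁/√g`. -/
def mup (L : Pt 2 → ℂ) (i : Fin 2) (p : Pt 2) : ℂ :=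
  if i = 0 then -(llow L 1 p) / sg L p else llow L 0 p / sg L p

/-- `m_i := g_{i j̄} m̄^j`. -/
def mlow (L : Pt 2 → ℂ) (i : Fin 2) (p : Pt 2) : ℂ :=
  ∑ j, gm L i j p * (starRingEnd ℂ) (mup L j p)

/-- `A := m^j m^k l_h C^h_{kj}`. -/
def sA (L : Pt 2 → ℂ) (p : Pt 2) : ℂ :=
  ∑ j, ∑ k, ∑ h, mup L j p * mup L k p * llow L h p * Cc L h k j p

/-- `B := m_h m^k m^j C^h_{jk}`. -/
def sB (L : Pt 2 → ℂ) (p : Pt 2) : ℂ :=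
  ∑ j, ∑ k, ∑ h, mlow L h p * mup L k p * mup L j p * Cc L h j k p

/-- `J := l^j l^k l_i L^i_{jk}`. -/
def sJ (L : Pt 2 → ℂ) (p : Pt 2) : ℂ :=
  ∑ j, ∑ k, ∑ i, lup L j p * lup L k p * llow L i p * Lc L i j k p

/-- `U := m^j l^k l_i L^i_{jk}`. -/
def sU (L : Pt 2 → ℂ) (p : Pt 2) : ℂ :=
  ∑ j, ∑ k, ∑ i, mup L j p * lup L k p * llow L i p * Lc L i j k p

/-- `V := l^j m^k l_i L^i_{jk}`. -/
def sV (L : Pt 2 → ℂ) (p : Pt 2) : ℂ :=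
  ∑ j, ∑ k, ∑ i, lup L j p * mup L k p * llow L i p * Lc L i j k p

/-- `X := m^j m^k l_i L^i_{jk}`. -/
def sX (L : Pt 2 → ℂ) (p : Pt 2) : ℂ :=
  ∑ j, ∑ k, ∑ i, mup L j p * mup L k p * llow L i p * Lc L i j k p

/-- `O := l^j l^k m_i L^i_{jk}`. -/
def sO (L : Pt 2 → ℂ) (p : Pt 2) : ℂ :=
  ∑ j, ∑ k, ∑ i, lup L j p * lup L k p * mlow L i p * Lc L i j k p

/-- `Y := m^j l^k m_i L^i_{jk}`. -/
def sY (L : Pt 2 → ℂ) (p : Pt 2) : ℂ :=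
  ∑ j, ∑ k, ∑ i, mup L j p * lup L k p * mlow L i p * Lc L i j k p

/-- `E := l^j m^k m_i L^i_{jk}`. -/
def sE (L : Pt 2 → ℂ) (p : Pt 2) : ℂ :=
  ∑ j, ∑ k, ∑ i, lup L j p * mup L k p * mlow L i p * Lc L i j k p

/-- `H := m^j m^k m_i L^i_{jk}`. -/
def sH (L : Pt 2 → ℂ) (p : Pt 2) : ℂ :=
  ∑ j, ∑ k, ∑ i, mup L j p * mup L k p * mlow L i p * Lc L i j k p

/-- The vertical curvature invariant `I := −(∂B/∂η̄^s) m̄^s − B B̄/2`. -/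
def vI (L : Pt 2 → ℂ) (p : Pt 2) : ℂ :=
  -(∑ s, debar (sB L) s p * (starRingEnd ℂ) (mup L s p)) -
    sB L p * (starRingEnd ℂ) (sB L p) / 2

/-- The `v v̄`-Riemann type tensor `S_{r̄ j h̄ k} := −g_{i r̄} ∂C^i_{jk}/∂η̄^h`. -/
def Sv (L : Pt 2 → ℂ) (r j h k : Fin 2) (p : Pt 2) : ℂ :=
  -∑ i, gm L i r p * debar (Cc L i j k) h p

/-- The `h h̄`-Riemann type tensor
`R_{r̄ j h̄ k} := g_{i r̄} (−δ_h̄(L^i_{jk}) − δ_h̄(N^l_k) C^i_{jl})`. -/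
def Rh (L : Pt 2 → ℂ) (r j h k : Fin 2) (p : Pt 2) : ℂ :=
  ∑ i, gm L i r p *
    (-(delbar L (Lc L i j k) h p) - ∑ l, delbar L (Nc L l k) h p * Cc L i j l p)

/-- The horizontal curvature invariant `K := −(1/F) δ_k̄(J) η̄^k`. -/
def hK (L : Pt 2 → ℂ) (p : Pt 2) : ℂ :=
  -(1 / Fh L p) * ∑ k, delbar L (sJ L) k p * (starRingEnd ℂ) (p.2 k)

/-- The horizontal curvature invariant
`W := −δ_s̄(H) m̄^s − ½ H (V̄+H̄) − B F δ_s̄(E) m̄^s`. -/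
def hW (L : Pt 2 → ℂ) (p : Pt 2) : ℂ :=
  -(∑ s, delbar L (sH L) s p * (starRingEnd ℂ) (mup L s p)) -
    (1 / 2) * sH L p * ((starRingEnd ℂ) (sV L p) + (starRingEnd ℂ) (sH L p)) -
    sB L p * Fh L p * ∑ s, delbar L (sE L) s p * (starRingEnd ℂ) (mup L s p)

/-- The weak symmetry condition `R_{0̄ k 0̄ 0} = R_{0̄ 0 0̄ k}`, i.e.
`R_{r̄ k h̄ s} η̄^r η̄^h η^s = R_{r̄ s h̄ k} η̄^r η^s η̄^h`. -/
def WeakSym (L : Pt 2 → ℂ) (D : Set (Pt 2)) : Prop :=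
  ∀ p ∈ D, ∀ k,
    (∑ r, ∑ h, ∑ s, Rh L r k h s p * (starRingEnd ℂ) (p.2 r) *
      (starRingEnd ℂ) (p.2 h) * p.2 s) =
    ∑ r, ∑ s, ∑ h, Rh L r s h k p * (starRingEnd ℂ) (p.2 r) * p.2 s *
      (starRingEnd ℂ) (p.2 h)


open scoped ComplexConjugate ContDiff
open Filter Topology

section Wirtinger

variable {E : Type*} [NormedAddCommGroup E] [NormedSpace ℝ E]

/-- The first-order operator `½ (∂_v + c ∂_w)`; the Wirtinger derivatives are instances. -/
def wirt (c : ℂ) (v w : E) (f : E → ℂ) (p : E) : ℂ :=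
  (1 / 2) * (fderiv ℝ f p v + c * fderiv ℝ f p w)

theorem dz_eq (f : Pt n → ℂ) (k : Fin n) :
    dz f k = wirt (-I) ((Pi.single k 1 : Fin n → ℂ), 0) ((Pi.single k I : Fin n → ℂ), 0) f := by
  funext p; simp only [dz, wirt]; ring

theorem de_eq (f : Pt n → ℂ) (k : Fin n) :
    de f k = wirt (-I) (0, (Pi.single k 1 : Fin n → ℂ)) (0, (Pi.single k I : Fin n → ℂ)) f := by
  funext p; simp only [de, wirt]; ring

theorem dzbar_eq (f : Pt n → ℂ) (k : Fin n) :
    dzbar f k = wirt I ((Pi.single k 1 : Fin n → ℂ), 0) ((Pi.single k I : Fin n → ℂ), 0) f :=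
  rfl

theorem debar_eq (f : Pt n → ℂ) (k : Fin n) :
    debar f k = wirt I (0, (Pi.single k 1 : Fin n → ℂ)) (0, (Pi.single k I : Fin n → ℂ)) f :=
  rfl

theorem contDiffAt_wirt {f : E → ℂ} {p : E} (hf : ContDiffAt ℝ ∞ f p) (c : ℂ) (v w : E) :
    ContDiffAt ℝ ∞ (wirt c v w f) p := by
  have h : ContDiffAt ℝ ∞ (fderiv ℝ f) p := hf.fderiv_right (by norm_num)
  exact contDiffAt_const.mul ((h.clm_apply contDiffAt_const).add
    (contDiffAt_const.mul (h.clm_apply contDiffAt_const)))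

theorem wirt_comm {f : E → ℂ} {p : E} (hf : ContDiffAt ℝ ∞ f p) (c d : ℂ) (v w x y : E) :
    wirt c v w (wirt d x y f) p = wirt d x y (wirt c v w f) p := by
  have h : DifferentiableAt ℝ (fderiv ℝ f) p :=
    (hf.fderiv_right (m := ∞) (by norm_num)).differentiableAt (by simp)
  have key : ∀ (d : ℂ) (x y v : E), fderiv ℝ (wirt d x y f) p v =
      (1 / 2) * (fderiv ℝ (fderiv ℝ f) p v x + d * fderiv ℝ (fderiv ℝ f) p v y) := by
    intro d x y v
    have h1 : ∀ x, HasFDerivAt (fun q => fderiv ℝ f q x) ((fderiv ℝ (fderiv ℝ f) p).flip x) p := by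
      intro x
      simpa using h.hasFDerivAt.clm_apply (hasFDerivAt_const x p)
    have h2 : HasFDerivAt (wirt d x y f) _ p :=
      (((h1 x).add ((h1 y).const_mul d)).const_mul (1 / 2 : ℂ))
    rw [h2.fderiv]
    simp [mul_add]
  have hs : IsSymmSndFDerivAt ℝ f p := by
    refine hf.isSymmSndFDerivAt ?_
    rw [minSmoothness_of_isRCLikeNormedField]
    exact WithTop.coe_le_coe.2 (le_top : (2 : ℕ∞) ≤ ⊤)
  simp only [wirt] at key ⊢
  rw [key, key, key, key, hs.eq v x, hs.eq v y, hs.eq w x, hs.eq w y]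
  ring

theorem wirt_conj {f : E → ℂ} {p : E} (hf : DifferentiableAt ℝ f p) (c : ℂ) (v w : E) :
    wirt c v w (fun q => conj (f q)) p = conj (wirt (conj c) v w f p) := by
  have h : HasFDerivAt (fun q => conj (f q))
      (Complex.conjCLE.toContinuousLinearMap ∘L fderiv ℝ f p) p :=
    Complex.conjCLE.toContinuousLinearMap.hasFDerivAt.comp p hf.hasFDerivAt
  simp [wirt, h.fderiv, Complex.conj_ofNat]

/-- `X` behaves like a first-order differential operator evaluated at `p`. -/
structure IsDerivationAt (p : E) (X : (E → ℂ) → ℂ) : Prop where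
  congr : ∀ {f g : E → ℂ}, f =ᶠ[𝓝 p] g → X f = X g
  add : ∀ {f g : E → ℂ}, ContDiffAt ℝ ∞ f p → ContDiffAt ℝ ∞ g p →
    X (fun q => f q + g q) = X f + X g
  mul : ∀ {f g : E → ℂ}, ContDiffAt ℝ ∞ f p → ContDiffAt ℝ ∞ g p →
    X (fun q => f q * g q) = X f * g p + f p * X g

theorem isDerivationAt_wirt (c : ℂ) (v w p : E) : IsDerivationAt p (fun f => wirt c v w f p) where
  congr h := by simp only [wirt, h.fderiv_eq]
  add hf hg := by
    simp only [wirt]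
    rw [fderiv_fun_add (hf.differentiableAt (by simp)) (hg.differentiableAt (by simp))]
    simp; ring
  mul hf hg := by
    simp only [wirt]
    rw [fderiv_fun_mul (hf.differentiableAt (by simp)) (hg.differentiableAt (by simp))]
    simp; ring

namespace IsDerivationAt

variable {p : E} {X : (E → ℂ) → ℂ}

theorem neg (hX : IsDerivationAt p X) {f : E → ℂ} (hf : ContDiffAt ℝ ∞ f p) :
    X (fun q => -f q) = -X f := by
  have h0 : X (fun _ => 0) = 0 := by
    have := hX.add (f := fun _ => 0) (g := fun _ => 0) contDiffAt_const contDiffAt_const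
    simpa using this
  have := hX.add hf hf.neg
  simp only [add_neg_cancel, h0] at this
  exact (neg_eq_of_add_eq_zero_right this.symm).symm

theorem sub (hX : IsDerivationAt p X) {f g : E → ℂ}
    (hf : ContDiffAt ℝ ∞ f p) (hg : ContDiffAt ℝ ∞ g p) :
    X (fun q => f q - g q) = X f - X g := by
  simp only [sub_eq_add_neg]
  rw [hX.add hf hg.neg, ← hX.neg hg]

theorem sum (hX : IsDerivationAt p X) {ι : Type*} (s : Finset ι) {f : ι → E → ℂ}
    (hf : ∀ i, ContDiffAt ℝ ∞ (f i) p) :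
    X (fun q => ∑ i ∈ s, f i q) = ∑ i ∈ s, X (f i) := by
  classical
  induction s using Finset.induction_on with
  | empty =>
    have := hX.add (f := fun _ => 0) (g := fun _ => 0) contDiffAt_const contDiffAt_const
    simpa using this
  | insert a s ha ih =>
    simp only [Finset.sum_insert ha]
    rw [hX.add (hf a) (ContDiffAt.sum fun i _ => hf i), ih]

end IsDerivationAt

end Wirtinger

section Coordinates

variable {f : Pt n → ℂ} {p : Pt n}

theorem contDiffAt_de (hf : ContDiffAt ℝ ∞ f p) (k : Fin n) : ContDiffAt ℝ ∞ (de f k) p := by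
  rw [de_eq]; exact contDiffAt_wirt hf _ _ _

theorem contDiffAt_debar (hf : ContDiffAt ℝ ∞ f p) (k : Fin n) :
    ContDiffAt ℝ ∞ (debar f k) p := by
  rw [debar_eq]; exact contDiffAt_wirt hf _ _ _

theorem isDerivationAt_dz (k : Fin n) (p : Pt n) : IsDerivationAt p (fun f => dz f k p) := by
  simp only [dz_eq]; exact isDerivationAt_wirt ..

theorem isDerivationAt_de (k : Fin n) (p : Pt n) : IsDerivationAt p (fun f => de f k p) := by
  simp only [de_eq]; exact isDerivationAt_wirt ..

theorem isDerivationAt_debar (k : Fin n) (p : Pt n) : IsDerivationAt p (fun f => debar f k p) := by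
  simp only [debar_eq]; exact isDerivationAt_wirt ..

theorem de_conj (hf : ContDiffAt ℝ ∞ f p) (k : Fin n) :
    de (fun q => conj (f q)) k p = conj (debar f k p) := by
  rw [de_eq, debar_eq, wirt_conj (hf.differentiableAt (by simp))]; simp

theorem debar_conj (hf : ContDiffAt ℝ ∞ f p) (k : Fin n) :
    debar (fun q => conj (f q)) k p = conj (de f k p) := by
  rw [de_eq, debar_eq, wirt_conj (hf.differentiableAt (by simp))]; simp

theorem dzbar_conj (hf : ContDiffAt ℝ ∞ f p) (k : Fin n) :
    dzbar (fun q => conj (f q)) k p = conj (dz f k p) := by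
  rw [dz_eq, dzbar_eq, wirt_conj (hf.differentiableAt (by simp))]; simp

theorem de_debar_comm (hf : ContDiffAt ℝ ∞ f p) (j k : Fin n) :
    de (debar f j) k p = debar (de f k) j p := by
  simp only [de_eq, debar_eq]; exact wirt_comm hf ..

theorem de_de_comm (hf : ContDiffAt ℝ ∞ f p) (j k : Fin n) :
    de (de f j) k p = de (de f k) j p := by
  simp only [de_eq]; exact wirt_comm hf ..

theorem contDiffAt_conj {E : Type*} [NormedAddCommGroup E] [NormedSpace ℝ E] {f : E → ℂ} {p : E}
    (hf : ContDiffAt ℝ ∞ f p) : ContDiffAt ℝ ∞ (fun q => conj (f q)) p :=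
  Complex.conjCLE.contDiff.contDiffAt.comp p hf

theorem contDiffAt_snd_apply (i : Fin n) : ContDiffAt ℝ ∞ (fun q : Pt n => q.2 i) p := by
  fun_prop

theorem fderiv_snd_apply (i : Fin n) (v : Pt n) :
    fderiv ℝ (fun q : Pt n => q.2 i) p v = v.2 i := by
  have h : HasFDerivAt (fun q : Pt n => q.2 i)
      ((ContinuousLinearMap.proj (R := ℝ) (φ := fun _ : Fin n => ℂ) i) ∘L
        ContinuousLinearMap.snd ℝ (Fin n → ℂ) (Fin n → ℂ)) p :=
    ((ContinuousLinearMap.proj (R := ℝ) (φ := fun _ : Fin n => ℂ) i) ∘L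
      ContinuousLinearMap.snd ℝ (Fin n → ℂ) (Fin n → ℂ)).hasFDerivAt
  rw [h.fderiv]; rfl

theorem dz_snd_apply (i k : Fin n) : dz (fun q : Pt n => q.2 i) k p = 0 := by
  simp [dz, fderiv_snd_apply]

theorem dzbar_snd_apply (i k : Fin n) : dzbar (fun q : Pt n => q.2 i) k p = 0 := by
  simp [dzbar, fderiv_snd_apply]

theorem de_snd_apply (i k : Fin n) :
    de (fun q : Pt n => q.2 i) k p = if i = k then 1 else 0 := by
  by_cases h : i = k
  · subst h; simp [de, fderiv_snd_apply]; norm_num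
  · simp [de, fderiv_snd_apply, h]

theorem debar_snd_apply (i k : Fin n) : debar (fun q : Pt n => q.2 i) k p = 0 := by
  by_cases h : i = k
  · subst h; simp [debar, fderiv_snd_apply]
  · simp [debar, fderiv_snd_apply, h]

theorem de_conj_snd_apply (i k : Fin n) : de (fun q : Pt n => conj (q.2 i)) k p = 0 := by
  rw [de_conj (contDiffAt_snd_apply i), debar_snd_apply, map_zero]

theorem dz_conj_snd_apply (i k : Fin n) : dz (fun q : Pt n => conj (q.2 i)) k p = 0 := by
  rw [dz_eq, wirt_conj ((contDiffAt_snd_apply i).differentiableAt (by simp))]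
  simpa [dzbar_eq] using dzbar_snd_apply (p := p) i k

theorem vec_eq_sum (w : Fin n → ℂ) :
    w = ∑ k, ((w k).re • (Pi.single k 1 : Fin n → ℂ) + (w k).im • (Pi.single k I : Fin n → ℂ)) := by
  funext i
  simp only [Finset.sum_apply, Pi.add_apply, Pi.smul_apply]
  rw [Finset.sum_eq_single i]
  · simp [Complex.re_add_im]
  · intro k _ hk
    simp [hk.symm]
  · simp

theorem clm_fst_eq_sum (A : Pt n →L[ℝ] ℂ) (w : Fin n → ℂ) :
    A (w, 0) = ∑ k, ((w k).re * A ((Pi.single k 1 : Fin n → ℂ), 0) +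
      (w k).im * A ((Pi.single k I : Fin n → ℂ), 0)) := by
  have h := congrArg (A ∘L ContinuousLinearMap.inl ℝ (Fin n → ℂ) (Fin n → ℂ)) (vec_eq_sum w)
  simpa only [map_sum, map_add, map_smul, ContinuousLinearMap.comp_apply,
    ContinuousLinearMap.inl_apply, Complex.real_smul] using h

theorem clm_snd_eq_sum (A : Pt n →L[ℝ] ℂ) (w : Fin n → ℂ) :
    A (0, w) = ∑ k, ((w k).re * A (0, (Pi.single k 1 : Fin n → ℂ)) +
      (w k).im * A (0, (Pi.single k I : Fin n → ℂ))) := by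
  have h := congrArg (A ∘L ContinuousLinearMap.inr ℝ (Fin n → ℂ) (Fin n → ℂ)) (vec_eq_sum w)
  simpa only [map_sum, map_add, map_smul, ContinuousLinearMap.comp_apply,
    ContinuousLinearMap.inr_apply, Complex.real_smul] using h

theorem fderiv_snd_eq_sum (w : Fin n → ℂ) :
    fderiv ℝ f p (0, w) = ∑ k, (w k * de f k p + conj (w k) * debar f k p) := by
  rw [clm_snd_eq_sum]
  refine Finset.sum_congr rfl fun k _ => ?_
  have h1 : (w k) = (w k).re + (w k).im * I := (Complex.re_add_im _).symm
  have h2 : conj (w k) = (w k).re - (w k).im * I := by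
    apply Complex.ext <;> simp
  rw [h2]
  conv_rhs => enter [1, 1]; rw [h1]
  simp only [de, debar]
  linear_combination ((w k).im * fderiv ℝ f p (0, (Pi.single k I : Fin n → ℂ))) * Complex.I_sq

theorem fderiv_fst_eq_sum (w : Fin n → ℂ) :
    fderiv ℝ f p (w, 0) = ∑ k, (w k * dz f k p + conj (w k) * dzbar f k p) := by
  rw [clm_fst_eq_sum]
  refine Finset.sum_congr rfl fun k _ => ?_
  have h1 : (w k) = (w k).re + (w k).im * I := (Complex.re_add_im _).symm
  have h2 : conj (w k) = (w k).re - (w k).im * I := by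
    apply Complex.ext <;> simp
  rw [h2]
  conv_rhs => enter [1, 1]; rw [h1]
  simp only [dz, dzbar]
  linear_combination ((w k).im * fderiv ℝ f p ((Pi.single k I : Fin n → ℂ), 0)) * Complex.I_sq

theorem fderiv_eq_zero_of_wirtinger (h1 : ∀ k, dz f k p = 0) (h2 : ∀ k, dzbar f k p = 0)
    (h3 : ∀ k, de f k p = 0) (h4 : ∀ k, debar f k p = 0) : fderiv ℝ f p = 0 := by
  refine ContinuousLinearMap.ext fun v => ?_
  have hv : v = (v.1, 0) + (0, v.2) := by simp
  rw [hv, map_add, fderiv_fst_eq_sum, fderiv_snd_eq_sum]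
  simp [h1, h2, h3, h4]

end Coordinates

namespace IsCFM

variable {D : Set (Pt n)} {L : Pt n → ℂ} {p : Pt n}

theorem eventually_mem (hL : IsCFM n D L) (hp : p ∈ D) : ∀ᶠ q in 𝓝 p, q ∈ D := hL.openD.mem_nhds hp

theorem smoothAt (hL : IsCFM n D L) (hp : p ∈ D) : ContDiffAt ℝ ∞ L p :=
  hL.smooth.contDiffAt (hL.eventually_mem hp)

theorem contDiffAt_gm (hL : IsCFM n D L) (hp : p ∈ D) (i j : Fin n) : ContDiffAt ℝ ∞ (gm L i j) p :=
  contDiffAt_de (contDiffAt_debar (hL.smoothAt hp) j) i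

theorem fderiv_fiber (hL : IsCFM n D L) (hp : p ∈ D) (a : ℂ) :
    fderiv ℝ L p (0, a • p.2) = 2 * a.re * L p := by
  have hf : HasFDerivAt L (fderiv ℝ L p) (p.1, p.2 + (0 : ℝ) • (a • p.2)) := by
    simpa using ((hL.smoothAt hp).differentiableAt (by simp)).hasFDerivAt
  have hc : HasDerivAt (fun t : ℝ => ((p.1, p.2 + t • (a • p.2)) : Pt n)) (0, a • p.2) 0 := by
    have h2 : HasDerivAt (fun t : ℝ => p.2 + t • (a • p.2)) (a • p.2) 0 := by
      simpa using ((hasDerivAt_id (0 : ℝ)).smul_const (a • p.2)).const_add p.2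
    exact (hasDerivAt_const (0 : ℝ) p.1).prodMk h2
  have h1 := hf.comp_hasDerivAt (0 : ℝ) hc
  have h2 : HasDerivAt (fun t : ℝ => (((1 + t * a.re) ^ 2 + (t * a.im) ^ 2 : ℝ) : ℂ) * L p)
      (2 * a.re * L p) 0 := by
    have h3 : HasDerivAt (fun t : ℝ => (1 + t * a.re) ^ 2 + (t * a.im) ^ 2) (2 * a.re) 0 := by
      have h4 := (((hasDerivAt_id (0 : ℝ)).mul_const a.re).const_add 1).pow 2
      have h5 := ((hasDerivAt_id (0 : ℝ)).mul_const a.im).pow 2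
      refine (h4.add h5).congr_deriv ?_
      simp
    simpa using h3.ofReal_comp.mul_const (L p)
  refine h1.unique (h2.congr_of_eventuallyEq ?_)
  have hne : ∀ᶠ t : ℝ in 𝓝 0, (1 + t * a : ℂ) ≠ 0 := by
    have : ContinuousAt (fun t : ℝ => (1 + t * a : ℂ)) 0 := by fun_prop
    exact this.eventually_ne (by simp)
  filter_upwards [hne] with t ht
  have := hL.homog p hp _ ht
  have e : (1 + t * a : ℂ) • p.2 = p.2 + t • (a • p.2) := by
    funext i; simp; ring
  simp only [Function.comp_apply]
  rw [← e, this]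
  congr 2
  simp [Complex.normSq_apply]; ring

theorem sum_mul_de (hL : IsCFM n D L) (hp : p ∈ D) : ∑ k, p.2 k * de L k p = L p := by
  have h1 := hL.fderiv_fiber hp 1
  have h2 := hL.fderiv_fiber hp I
  rw [fderiv_snd_eq_sum, Finset.sum_add_distrib] at h1 h2
  simp only [Pi.smul_apply, smul_eq_mul, one_mul, map_mul, conj_I, mul_assoc, neg_mul,
    ← Finset.mul_sum, Finset.sum_neg_distrib, one_re, I_re,
    ofReal_one, ofReal_zero, zero_mul, mul_zero] at h1 h2
  linear_combination (1 / 2) * h1 - (I / 2) * h2 +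
    (1 / 2) * (∑ k, p.2 k * de L k p - ∑ k, conj (p.2 k) * debar L k p) * I_sq

theorem conj_apply (hL : IsCFM n D L) (hp : p ∈ D) : conj (L p) = L p :=
  Complex.conj_eq_iff_im.2 (hL.real_im p hp)

theorem conj_de (hL : IsCFM n D L) (hp : p ∈ D) (k : Fin n) : conj (de L k p) = debar L k p := by
  rw [← debar_conj (hL.smoothAt hp)]
  exact (isDerivationAt_debar k p).congr ((hL.eventually_mem hp).mono fun q hq => hL.conj_apply hq)

/-- `η^k g_{k j̄} = ∂L/∂η̄^j`. -/
theorem sum_mul_gm (hL : IsCFM n D L) (hp : p ∈ D) (j : Fin n) :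
    ∑ k, p.2 k * gm L k j p = debar L j p := by
  have hX := isDerivationAt_debar j p
  have h := hX.congr ((hL.eventually_mem hp).mono fun q hq => hL.sum_mul_de hq)
  have hk := fun k => contDiffAt_de (hL.smoothAt hp) k
  rw [hX.sum _ fun k => (contDiffAt_snd_apply k).mul (hk k)] at h
  rw [← h]
  refine Finset.sum_congr rfl fun k _ => ?_
  rw [hX.mul (contDiffAt_snd_apply k) (hk k), debar_snd_apply, gm, de_debar_comm (hL.smoothAt hp)]
  ring

/-- `g_{i j̄} η̄^j = ∂L/∂η^i`. -/
theorem sum_gm_mul_conj (hL : IsCFM n D L) (hp : p ∈ D) (i : Fin n) :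
    ∑ j, gm L i j p * conj (p.2 j) = de L i p := by
  have h := congrArg conj (hL.sum_mul_gm hp i)
  rw [← hL.conj_de hp, Complex.conj_conj] at h
  rw [← h, map_sum]
  refine Finset.sum_congr rfl fun j _ => ?_
  rw [map_mul, hL.hermitian p hp]; ring

theorem de_gm_symm (hL : IsCFM n D L) (hp : p ∈ D) (i j k : Fin n) :
    de (gm L i j) k p = de (gm L k j) i p :=
  de_de_comm (contDiffAt_debar (hL.smoothAt hp) j) i k

/-- `η^i ∂g_{i j̄}/∂η^k = 0`. -/
theorem sum_mul_de_gm (hL : IsCFM n D L) (hp : p ∈ D) (j k : Fin n) :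
    ∑ i, p.2 i * de (gm L i j) k p = 0 := by
  have hX := isDerivationAt_de k p
  have h := hX.congr ((hL.eventually_mem hp).mono fun q hq => hL.sum_mul_gm hq j)
  have hk := fun i => hL.contDiffAt_gm hp i j
  rw [hX.sum _ fun i => (contDiffAt_snd_apply i).mul (hk i)] at h
  simp only [hX.mul (contDiffAt_snd_apply _) (hk _), de_snd_apply, Finset.sum_add_distrib,
    ite_mul, one_mul, zero_mul, Finset.sum_ite_eq', Finset.mem_univ, if_true] at h
  simpa [gm] using h

/-- `∂²L/∂η^i∂η^k = η̄^j ∂g_{i j̄}/∂η^k`. -/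
theorem sum_conj_mul_de_gm (hL : IsCFM n D L) (hp : p ∈ D) (i k : Fin n) :
    ∑ j, conj (p.2 j) * de (gm L i j) k p = de (de L i) k p := by
  have hX := isDerivationAt_de k p
  have h := hX.congr ((hL.eventually_mem hp).mono fun q hq => hL.sum_gm_mul_conj hq i)
  have hk := fun j => hL.contDiffAt_gm hp i j
  have hc := fun j => contDiffAt_conj (contDiffAt_snd_apply (p := p) j)
  rw [hX.sum _ fun j => (hk j).mul (hc j)] at h
  simp only [hX.mul (hk _) (hc _), de_conj_snd_apply, mul_zero, add_zero] at h
  rw [← h]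
  exact Finset.sum_congr rfl fun j _ => mul_comm _ _

theorem debar_gm (hL : IsCFM n D L) (hp : p ∈ D) (i j k : Fin n) :
    debar (gm L i j) k p = conj (de (gm L j i) k p) := by
  rw [← debar_conj (hL.contDiffAt_gm hp j i)]
  exact (isDerivationAt_debar k p).congr
    ((hL.eventually_mem hp).mono fun q hq => (hL.hermitian q hq j i).symm)

theorem conj_debar_de_gm (hL : IsCFM n D L) (hp : p ∈ D) (j r k s : Fin n) :
    conj (debar (de (gm L j r) k) s p) = debar (de (gm L r j) s) k p := by
  rw [← de_conj (contDiffAt_de (hL.contDiffAt_gm hp j r) k), ← de_debar_comm (hL.contDiffAt_gm hp r j)]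
  exact (isDerivationAt_de s p).congr
    ((hL.eventually_mem hp).mono fun q hq => (hL.debar_gm hq r j k).symm)

/-- `η^l η̄^m ∂g_{l m̄}/∂z^k = ∂L/∂z^k`. -/
theorem sum_dz_gm (hL : IsCFM n D L) (hp : p ∈ D) (k : Fin n) :
    ∑ m, ∑ l, dz (gm L l m) k p * p.2 l * conj (p.2 m) = dz L k p := by
  have hX := isDerivationAt_dz k p
  have e : ∀ q ∈ D, (∑ m, ∑ l, gm L l m q * q.2 l * conj (q.2 m)) = L q := by
    intro q hq
    rw [Finset.sum_comm, ← hL.sum_mul_de hq]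
    refine Finset.sum_congr rfl fun l _ => ?_
    rw [← hL.sum_gm_mul_conj hq, Finset.mul_sum]
    exact Finset.sum_congr rfl fun m _ => by ring
  have h := hX.congr ((hL.eventually_mem hp).mono e)
  have hg := fun l m => hL.contDiffAt_gm hp l m
  have hs := fun l => contDiffAt_snd_apply (p := p) l
  have hc := fun j => contDiffAt_conj (hs j)
  rw [← h, hX.sum _ fun m => ContDiffAt.sum fun l _ => ((hg l m).mul (hs l)).mul (hc m)]
  refine Finset.sum_congr rfl fun m _ => ?_
  rw [hX.sum _ fun l => ((hg l m).mul (hs l)).mul (hc m)]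
  refine Finset.sum_congr rfl fun l _ => ?_
  rw [hX.mul ((hg l m).mul (hs l)) (hc m), hX.mul (hg l m) (hs l), dz_snd_apply,
    dz_conj_snd_apply]
  ring

end IsCFM

theorem IsDerivationAt.sum_smul {E : Type*} [NormedAddCommGroup E] [NormedSpace ℝ E] {p : E}
    {ι : Type*} [Fintype ι] {X : ι → (E → ℂ) → ℂ} (hX : ∀ i, IsDerivationAt p (X i)) (a : ι → ℂ) :
    IsDerivationAt p (fun f => ∑ i, a i * X i f) where
  congr h := Finset.sum_congr rfl fun i _ => by rw [(hX i).congr h]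
  add hf hg := by
    rw [← Finset.sum_add_distrib]
    exact Finset.sum_congr rfl fun i _ => by rw [(hX i).add hf hg]; ring
  mul hf hg := by
    rw [Finset.sum_mul, Finset.mul_sum, ← Finset.sum_add_distrib]
    exact Finset.sum_congr rfl fun i _ => by rw [(hX i).mul hf hg]; ring

theorem contDiffAt_ofReal_sqrt_re {E : Type*} [NormedAddCommGroup E] [NormedSpace ℝ E] {f : E → ℂ}
    {p : E} (hf : ContDiffAt ℝ ∞ f p) (h : (f p).re ≠ 0) :
    ContDiffAt ℝ ∞ (fun q => ((Real.sqrt (f q).re : ℝ) : ℂ)) p := by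
  have h1 : ContDiffAt ℝ ∞ (fun q => (f q).re) p := Complex.reCLM.contDiff.contDiffAt.comp p hf
  exact Complex.ofRealCLM.contDiff.contDiffAt.comp p (h1.sqrt h)

theorem contDiffAt_div {E : Type*} [NormedAddCommGroup E] [NormedSpace ℝ E] {f g : E → ℂ} {p : E}
    (hf : ContDiffAt ℝ ∞ f p) (hg : ContDiffAt ℝ ∞ g p) (h : g p ≠ 0) :
    ContDiffAt ℝ ∞ (fun q => f q / g q) p := by
  simp only [div_eq_mul_inv]
  exact hf.mul (hg.inv h)

theorem ofReal_sqrt_re_sq {w : ℂ} (him : w.im = 0) (hre : 0 ≤ w.re) :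
    ((Real.sqrt w.re : ℝ) : ℂ) ^ 2 = w := by
  rw [← ofReal_pow, Real.sq_sqrt hre]
  apply Complex.ext <;> simp [him]

namespace IsCFM

section Frame

variable {D : Set (Pt n)} {L : Pt n → ℂ} {p : Pt n}

theorem ne_zero (hL : IsCFM n D L) (hp : p ∈ D) : L p ≠ 0 := fun h => by
  have := hL.pos p hp
  simp [h] at this

theorem Fh_sq (hL : IsCFM n D L) (hp : p ∈ D) : Fh L p ^ 2 = L p :=
  ofReal_sqrt_re_sq (hL.real_im p hp) (hL.pos p hp).le

theorem Fh_ne_zero (hL : IsCFM n D L) (hp : p ∈ D) : Fh L p ≠ 0 := fun h =>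
  hL.ne_zero hp (by rw [← hL.Fh_sq hp, h]; simp)

theorem llow_mul_Fh (hL : IsCFM n D L) (hp : p ∈ D) (i : Fin n) :
    llow L i p * Fh L p = de L i p := by
  rw [llow, div_mul_cancel₀ _ (hL.Fh_ne_zero hp), hL.sum_gm_mul_conj hp]

end Frame

variable {D : Set (Pt 2)} {L : Pt 2 → ℂ} {p : Pt 2}

theorem det_pos (hL : IsCFM 2 D L) (hp : p ∈ D) :
    0 < (gmat L p).det.re ∧ (gmat L p).det.im = 0 := by
  have h00 := Complex.conj_eq_iff_im.1 (hL.hermitian p hp 0 0)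
  have h11 := Complex.conj_eq_iff_im.1 (hL.hermitian p hp 1 1)
  have h01 := hL.hermitian p hp 0 1
  have hre := congrArg Complex.re h01
  have him := congrArg Complex.im h01
  have v0 := hL.posdef p hp ![1, 0] (fun h => by simpa using congrFun h 0)
  have v1 := hL.posdef p hp ![-gm L 1 0 p, gm L 0 0 p] (fun h => by
    have := congrFun h 1
    simp at this
    simp [this] at v0)
  simp only [Fin.sum_univ_two, Matrix.det_fin_two, gmat, Matrix.cons_val_zero,
    Matrix.cons_val_one, add_re, mul_re, mul_im, conj_re, conj_im, neg_re, neg_im,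
    sub_re, sub_im, one_re, one_im, zero_re, zero_im] at *
  rw [h00] at *
  rw [h11] at *
  rw [← hre, ← him] at *
  constructor
  · refine pos_of_mul_pos_right (a := (gm L 0 0 p).re) ?_ ?_
    · nlinarith [v1]
    · nlinarith [v0]
  · ring

theorem sg_sq (hL : IsCFM 2 D L) (hp : p ∈ D) : sg L p ^ 2 = (gmat L p).det :=
  ofReal_sqrt_re_sq (hL.det_pos hp).2 (hL.det_pos hp).1.le

theorem det_ne_zero (hL : IsCFM 2 D L) (hp : p ∈ D) : (gmat L p).det ≠ 0 := fun h => by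
  have := (hL.det_pos hp).1
  simp [h] at this

theorem sg_ne_zero (hL : IsCFM 2 D L) (hp : p ∈ D) : sg L p ≠ 0 := fun h =>
  hL.det_ne_zero hp (by rw [← hL.sg_sq hp, h]; simp)

end IsCFM

/-- The normalising factor `√(L g)` of the vector `m`. -/
def frameScale (L : Pt 2 → ℂ) (p : Pt 2) : ℂ := Fh L p * sg L p

theorem conj_frameScale (L : Pt 2 → ℂ) (p : Pt 2) : conj (frameScale L p) = frameScale L p := by
  simp [frameScale, Fh, sg]

namespace IsCFM

variable {D : Set (Pt 2)} {L : Pt 2 → ℂ} {p : Pt 2}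

theorem frameScale_sq (hL : IsCFM 2 D L) (hp : p ∈ D) :
    frameScale L p * frameScale L p =
      L p * (gm L 0 0 p * gm L 1 1 p - gm L 0 1 p * gm L 1 0 p) := by
  have h1 := hL.Fh_sq hp
  have h2 := hL.sg_sq hp
  rw [Matrix.det_fin_two] at h2
  simp only [gmat] at h2
  rw [← h1, ← h2, frameScale]; ring

theorem frameScale_ne_zero (hL : IsCFM 2 D L) (hp : p ∈ D) : frameScale L p ≠ 0 :=
  mul_ne_zero (hL.Fh_ne_zero hp) (hL.sg_ne_zero hp)

theorem frameScale_mul_mup_zero (hL : IsCFM 2 D L) (hp : p ∈ D) :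
    frameScale L p * mup L 0 p = -de L 1 p := by
  rw [← hL.llow_mul_Fh hp, frameScale, mup, if_pos rfl]
  field_simp [hL.sg_ne_zero hp]

theorem frameScale_mul_mup_one (hL : IsCFM 2 D L) (hp : p ∈ D) :
    frameScale L p * mup L 1 p = de L 0 p := by
  rw [← hL.llow_mul_Fh hp, frameScale, mup, if_neg (by decide)]
  field_simp [hL.sg_ne_zero hp]

theorem contDiffAt_det (hL : IsCFM 2 D L) (hp : p ∈ D) :
    ContDiffAt ℝ ∞ (fun q => (gmat L q).det) p := by
  simp only [Matrix.det_fin_two, gmat]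
  have h := hL.contDiffAt_gm hp
  exact ((h _ _).mul (h _ _)).sub ((h _ _).mul (h _ _))

theorem contDiffAt_Fh (hL : IsCFM 2 D L) (hp : p ∈ D) : ContDiffAt ℝ ∞ (Fh L) p :=
  contDiffAt_ofReal_sqrt_re (hL.smoothAt hp) (hL.pos p hp).ne'

theorem contDiffAt_sg (hL : IsCFM 2 D L) (hp : p ∈ D) : ContDiffAt ℝ ∞ (sg L) p :=
  contDiffAt_ofReal_sqrt_re (hL.contDiffAt_det hp) (hL.det_pos hp).1.ne'

theorem contDiffAt_frameScale (hL : IsCFM 2 D L) (hp : p ∈ D) :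
    ContDiffAt ℝ ∞ (frameScale L) p :=
  (hL.contDiffAt_Fh hp).mul (hL.contDiffAt_sg hp)

theorem contDiffAt_mup (hL : IsCFM 2 D L) (hp : p ∈ D) (i : Fin 2) :
    ContDiffAt ℝ ∞ (mup L i) p := by
  have hl : ∀ i, ContDiffAt ℝ ∞ (llow L i) p := fun i =>
    contDiffAt_div (ContDiffAt.sum fun j _ => (hL.contDiffAt_gm hp i j).mul
      (contDiffAt_conj (contDiffAt_snd_apply j))) (hL.contDiffAt_Fh hp) (hL.Fh_ne_zero hp)
  fin_cases i
  · exact contDiffAt_div (hl 1).neg (hL.contDiffAt_sg hp) (hL.sg_ne_zero hp)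
  · exact contDiffAt_div (hl 0) (hL.contDiffAt_sg hp) (hL.sg_ne_zero hp)

theorem frameScale_mul_conj_mup_zero (hL : IsCFM 2 D L) (hp : p ∈ D) :
    frameScale L p * conj (mup L 0 p) = -(p.2 0 * gm L 0 1 p + p.2 1 * gm L 1 1 p) := by
  have h := congrArg conj (hL.frameScale_mul_mup_zero hp)
  rw [map_mul, map_neg, hL.conj_de hp, conj_frameScale, ← hL.sum_mul_gm hp] at h
  simpa [Fin.sum_univ_two] using h

theorem frameScale_mul_conj_mup_one (hL : IsCFM 2 D L) (hp : p ∈ D) :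
    frameScale L p * conj (mup L 1 p) = p.2 0 * gm L 0 0 p + p.2 1 * gm L 1 0 p := by
  have h := congrArg conj (hL.frameScale_mul_mup_one hp)
  rw [map_mul, hL.conj_de hp, conj_frameScale, ← hL.sum_mul_gm hp] at h
  simpa [Fin.sum_univ_two] using h

theorem mul_mlow_zero (hL : IsCFM 2 D L) (hp : p ∈ D) :
    L p * mlow L 0 p = -(frameScale L p * p.2 1) := by
  refine mul_left_cancel₀ (hL.frameScale_ne_zero hp) ?_
  simp only [mlow, Fin.sum_univ_two]
  linear_combination L p * gm L 0 0 p * hL.frameScale_mul_conj_mup_zero hp +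
    L p * gm L 0 1 p * hL.frameScale_mul_conj_mup_one hp + p.2 1 * hL.frameScale_sq hp

theorem mul_mlow_one (hL : IsCFM 2 D L) (hp : p ∈ D) :
    L p * mlow L 1 p = frameScale L p * p.2 0 := by
  refine mul_left_cancel₀ (hL.frameScale_ne_zero hp) ?_
  simp only [mlow, Fin.sum_univ_two]
  linear_combination L p * gm L 1 0 p * hL.frameScale_mul_conj_mup_zero hp +
    L p * gm L 1 1 p * hL.frameScale_mul_conj_mup_one hp - p.2 0 * hL.frameScale_sq hp

/-- The frame is unitary: `l_i l^k + m_i m^k = δ_i^k`. -/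
theorem frame_complete (hL : IsCFM 2 D L) (hp : p ∈ D) (i k : Fin 2) :
    de L i p * p.2 k / L p + mlow L i p * mup L k p = if i = k then 1 else 0 := by
  have hne := hL.ne_zero hp
  have e := hL.sum_mul_de hp
  have a0 := hL.mul_mlow_zero hp
  have a1 := hL.mul_mlow_one hp
  have b0 := hL.frameScale_mul_mup_zero hp
  have b1 := hL.frameScale_mul_mup_one hp
  rw [Fin.sum_univ_two] at e
  refine mul_left_cancel₀ hne ?_
  rw [mul_add, mul_div_cancel₀ _ hne]
  fin_cases i <;> fin_cases k <;> simp
  · linear_combination mup L 0 p * a0 - p.2 1 * b0 + e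
  · linear_combination mup L 1 p * a0 - p.2 1 * b1
  · linear_combination mup L 0 p * a1 + p.2 0 * b0
  · linear_combination mup L 1 p * a1 + p.2 0 * b1 + e

/-- `g^{l̄ i} = l^i l̄^l + m^i m̄^l`. -/
theorem gi_eq (hL : IsCFM 2 D L) (hp : p ∈ D) (l i : Fin 2) :
    gi L l i p = p.2 i * conj (p.2 l) / L p + mup L i p * conj (mup L l p) := by
  have h : gmat L p * Matrix.of (fun l i =>
      p.2 i * conj (p.2 l) / L p + mup L i p * conj (mup L l p)) = 1 := by
    ext a k
    rw [Matrix.mul_apply, Matrix.one_apply, ← hL.frame_complete hp a k,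
      ← hL.sum_gm_mul_conj hp a, mlow, Finset.sum_mul, Finset.sum_mul, Finset.sum_div,
      ← Finset.sum_add_distrib]
    refine Finset.sum_congr rfl fun j _ => ?_
    simp only [gmat, Matrix.of_apply]; ring
  rw [gi, Matrix.inv_eq_right_inv h, Matrix.of_apply]

theorem contDiffAt_gi (hL : IsCFM 2 D L) (hp : p ∈ D) (l i : Fin 2) :
    ContDiffAt ℝ ∞ (gi L l i) p := by
  refine ContDiffAt.congr_of_eventuallyEq ?_
    ((hL.eventually_mem hp).mono fun q hq => hL.gi_eq hq l i)
  exact (contDiffAt_div ((contDiffAt_snd_apply i).mul (contDiffAt_conj (contDiffAt_snd_apply l)))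
    (hL.smoothAt hp) (hL.ne_zero hp)).add
    ((hL.contDiffAt_mup hp i).mul (contDiffAt_conj (hL.contDiffAt_mup hp l)))

theorem contDiffAt_de_gm (hL : IsCFM 2 D L) (hp : p ∈ D) (i j k : Fin 2) :
    ContDiffAt ℝ ∞ (de (gm L i j) k) p :=
  contDiffAt_de (hL.contDiffAt_gm hp i j) k

theorem contDiffAt_Cc (hL : IsCFM 2 D L) (hp : p ∈ D) (i j k : Fin 2) :
    ContDiffAt ℝ ∞ (Cc L i j k) p :=
  ContDiffAt.sum fun l _ => (hL.contDiffAt_gi hp l i).mul (hL.contDiffAt_de_gm hp j l k)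

/-- `g_{i r̄} C^i_{jk} = ∂g_{j r̄}/∂η^k`. -/
theorem sum_gm_mul_Cc (hL : IsCFM 2 D L) (hp : p ∈ D) (r j k : Fin 2) :
    ∑ i, gm L i r p * Cc L i j k p = de (gm L j r) k p := by
  have h : (gmat L p)⁻¹ * gmat L p = 1 :=
    Matrix.nonsing_inv_mul _ (isUnit_iff_ne_zero.2 (hL.det_ne_zero hp))
  have h' : ∀ l, ∑ i, gi L l i p * gm L i r p = if l = r then 1 else 0 := fun l => by
    rw [← Matrix.one_apply, ← h, Matrix.mul_apply]; rfl
  simp only [Cc, Finset.mul_sum]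
  rw [Finset.sum_comm]
  have : ∀ l, ∑ i, gm L i r p * (gi L l i p * de (gm L j l) k p) =
      (if l = r then 1 else 0) * de (gm L j l) k p := fun l => by
    rw [← h', Finset.sum_mul]
    exact Finset.sum_congr rfl fun i _ => by ring
  simp [this]

theorem sB_eq (hL : IsCFM 2 D L) (hp : p ∈ D) :
    sB L p = ∑ j, ∑ k, ∑ r, mup L j p * mup L k p * conj (mup L r p) * de (gm L j r) k p := by
  refine Finset.sum_congr rfl fun j _ => Finset.sum_congr rfl fun k _ => ?_
  simp only [← hL.sum_gm_mul_Cc hp, mlow, Finset.sum_mul, Finset.mul_sum]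
  rw [Finset.sum_comm]
  exact Finset.sum_congr rfl fun r _ => Finset.sum_congr rfl fun i _ => by ring

theorem contDiffAt_sB (hL : IsCFM 2 D L) (hp : p ∈ D) : ContDiffAt ℝ ∞ (sB L) p := by
  refine ContDiffAt.congr_of_eventuallyEq ?_
    ((hL.eventually_mem hp).mono fun q hq => hL.sB_eq hq)
  have hm := hL.contDiffAt_mup hp
  exact ContDiffAt.sum fun j _ => ContDiffAt.sum fun k _ => ContDiffAt.sum fun r _ =>
    (((hm j).mul (hm k)).mul (contDiffAt_conj (hm r))).mul (hL.contDiffAt_de_gm hp j r k)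

theorem contDiffAt_vI (hL : IsCFM 2 D L) (hp : p ∈ D) : ContDiffAt ℝ ∞ (vI L) p := by
  have hB := hL.contDiffAt_sB hp
  exact (ContDiffAt.sum fun s _ => (contDiffAt_debar hB s).mul
    (contDiffAt_conj (hL.contDiffAt_mup hp s))).neg.sub
    ((hB.mul (contDiffAt_conj hB)).div_const 2)

end IsCFM

/-- The derivation along the frame vector `m` at `p`. -/
def derM (L : Pt 2 → ℂ) (p : Pt 2) (f : Pt 2 → ℂ) : ℂ := ∑ s, mup L s p * de f s p

/-- The derivation along the conjugate frame vector `m̄` at `p`. -/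
def derMbar (L : Pt 2 → ℂ) (p : Pt 2) (f : Pt 2 → ℂ) : ℂ := ∑ s, conj (mup L s p) * debar f s p

/-- The scalar `F A = m^j m^k η̄^r ∂g_{j r̄}/∂η^k`. -/
def scaledA (L : Pt 2 → ℂ) (p : Pt 2) : ℂ :=
  ∑ j, ∑ k, ∑ r, mup L j p * mup L k p * conj (p.2 r) * de (gm L j r) k p

/-- The scalar `m^j m^k m̄^r m̄^s ∂²g_{j r̄}/∂η^k∂η̄^s`. -/
def frameQuartic (L : Pt 2 → ℂ) (p : Pt 2) : ℂ :=
  ∑ j, ∑ k, ∑ r, mup L j p * mup L k p * conj (mup L r p) * derMbar L p (de (gm L j r) k)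

theorem isDerivationAt_derM (L : Pt 2 → ℂ) (p : Pt 2) : IsDerivationAt p (derM L p) :=
  IsDerivationAt.sum_smul (fun s => isDerivationAt_de s p) _

theorem isDerivationAt_derMbar (L : Pt 2 → ℂ) (p : Pt 2) : IsDerivationAt p (derMbar L p) :=
  IsDerivationAt.sum_smul (fun s => isDerivationAt_debar s p) _

theorem derMbar_conj (L : Pt 2 → ℂ) {p : Pt 2} {f : Pt 2 → ℂ} (hf : ContDiffAt ℝ ∞ f p) :
    derMbar L p (fun q => conj (f q)) = conj (derM L p f) := by
  simp only [derM, derMbar, map_sum, map_mul, debar_conj hf]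

namespace IsCFM

variable {D : Set (Pt 2)} {L : Pt 2 → ℂ} {p : Pt 2}

theorem derM_self (hL : IsCFM 2 D L) (hp : p ∈ D) : derM L p L = 0 := by
  refine mul_left_cancel₀ (hL.frameScale_ne_zero hp) ?_
  rw [derM, Fin.sum_univ_two]
  linear_combination de L 0 p * hL.frameScale_mul_mup_zero hp +
    de L 1 p * hL.frameScale_mul_mup_one hp

theorem derMbar_de (hL : IsCFM 2 D L) (hp : p ∈ D) (i : Fin 2) :
    derMbar L p (de L i) = mlow L i p := by
  refine Finset.sum_congr rfl fun s _ => ?_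
  rw [gm, de_debar_comm (hL.smoothAt hp)]; ring

theorem derM_gm (L : Pt 2 → ℂ) (p : Pt 2) (i j : Fin 2) :
    derM L p (gm L i j) = ∑ s, mup L s p * de (gm L i j) s p := rfl

/-- `m^s ∂²L/∂η^s∂η^i = F A m_i`. -/
theorem derM_de (hL : IsCFM 2 D L) (hp : p ∈ D) (i : Fin 2) :
    derM L p (de L i) = scaledA L p * mlow L i p := by
  have h0 : ∀ r k, ∑ i, p.2 i * de (gm L i r) k p = 0 := fun r k => hL.sum_mul_de_gm hp r k
  have hd : ∀ i, derM L p (de L i) =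
      ∑ s, mup L s p * ∑ r, conj (p.2 r) * de (gm L i r) s p := fun i =>
    Finset.sum_congr rfl fun s _ => by rw [hL.sum_conj_mul_de_gm hp]
  have hη : ∑ k, p.2 k * derM L p (de L k) = 0 := by
    simp only [hd, Fin.sum_univ_two] at h0 ⊢
    linear_combination mup L 0 p * conj (p.2 0) * h0 0 0 + mup L 0 p * conj (p.2 1) * h0 1 0 +
      mup L 1 p * conj (p.2 0) * h0 0 1 + mup L 1 p * conj (p.2 1) * h0 1 1
  have hm : ∑ k, mup L k p * derM L p (de L k) = scaledA L p := by
    simp only [hd, scaledA, Fin.sum_univ_two]; ring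
  have hk : derM L p (de L i) = ∑ k, (if i = k then 1 else 0) * derM L p (de L k) := by simp
  rw [hk]
  simp only [← hL.frame_complete hp]
  calc ∑ k, (de L i p * p.2 k / L p + mlow L i p * mup L k p) * derM L p (de L k)
      = de L i p / L p * ∑ k, p.2 k * derM L p (de L k) +
          mlow L i p * ∑ k, mup L k p * derM L p (de L k) := by
        rw [Finset.mul_sum, Finset.mul_sum, ← Finset.sum_add_distrib]
        exact Finset.sum_congr rfl fun k _ => by ring
    _ = _ := by rw [hη, hm]; ring

/-- `m`-derivative of the determinant of the fundamental tensor. -/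
theorem derM_det (hL : IsCFM 2 D L) (hp : p ∈ D) :
    derM L p (fun q => gm L 0 0 q * gm L 1 1 q - gm L 0 1 q * gm L 1 0 q) =
      (gm L 0 0 p * gm L 1 1 p - gm L 0 1 p * gm L 1 0 p) * sB L p := by
  have hX := isDerivationAt_derM L p
  have hg := hL.contDiffAt_gm hp
  have hB : sB L p = ∑ j, ∑ i, gi L j i p * derM L p (gm L i j) := by
    have h0 : ∀ r k, ∑ i, p.2 i * de (gm L i r) k p = 0 := fun r k => hL.sum_mul_de_gm hp r k
    rw [hL.sB_eq hp]
    simp only [hL.gi_eq hp, derM_gm, Fin.sum_univ_two] at h0 ⊢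
    linear_combination -(mup L 0 p * conj (p.2 0) / L p) * h0 0 0 -
      mup L 0 p * conj (p.2 1) / L p * h0 1 0 -
      mup L 1 p * conj (p.2 0) / L p * h0 0 1 - mup L 1 p * conj (p.2 1) / L p * h0 1 1
  have hgi : ∀ l i, (gm L 0 0 p * gm L 1 1 p - gm L 0 1 p * gm L 1 0 p) * gi L l i p =
      (gmat L p).adjugate l i := fun l i => by
    have hdet : (gmat L p).det = gm L 0 0 p * gm L 1 1 p - gm L 0 1 p * gm L 1 0 p := by
      rw [Matrix.det_fin_two]; rfl
    rw [← hdet, gi, Matrix.inv_def, Matrix.smul_apply, Ring.inverse_eq_inv', smul_eq_mul,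
      mul_inv_cancel_left₀ (hL.det_ne_zero hp)]
  have h00 := hgi 0 0
  have h01 := hgi 0 1
  have h10 := hgi 1 0
  have h11 := hgi 1 1
  simp only [Matrix.adjugate_fin_two, gmat, Matrix.of_apply, Matrix.cons_val_zero,
    Matrix.cons_val_one] at h00 h01 h10 h11
  rw [hX.sub ((hg 0 0).mul (hg 1 1)) ((hg 0 1).mul (hg 1 0)), hX.mul (hg 0 0) (hg 1 1),
    hX.mul (hg 0 1) (hg 1 0), hB]
  simp only [Fin.sum_univ_two]
  linear_combination -derM L p (gm L 0 0) * h00 - derM L p (gm L 1 0) * h01 -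
    derM L p (gm L 0 1) * h10 - derM L p (gm L 1 1) * h11

theorem derM_frameScale (hL : IsCFM 2 D L) (hp : p ∈ D) :
    derM L p (frameScale L) = sB L p / 2 * frameScale L p := by
  have hX := isDerivationAt_derM L p
  have hg := hL.contDiffAt_gm hp
  have hM := hL.contDiffAt_frameScale hp
  have h := hX.congr ((hL.eventually_mem hp).mono fun q hq => hL.frameScale_sq hq)
  rw [hX.mul hM hM, hX.mul (hL.smoothAt hp) (((hg 0 0).mul (hg 1 1)).sub ((hg 0 1).mul (hg 1 0))),
    hL.derM_det hp, hL.derM_self hp] at h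
  refine mul_left_cancel₀ (hL.frameScale_ne_zero hp) ?_
  linear_combination (1 / 2) * h - sB L p / 2 * hL.frameScale_sq hp

theorem derMbar_frameScale (hL : IsCFM 2 D L) (hp : p ∈ D) :
    derMbar L p (frameScale L) = conj (sB L p) / 2 * frameScale L p := by
  have h := derMbar_conj L (hL.contDiffAt_frameScale hp)
  simp only [conj_frameScale] at h
  rw [h, hL.derM_frameScale hp]
  simp [conj_frameScale, Complex.conj_ofNat]

theorem derivation_mup (hL : IsCFM 2 D L) (hp : p ∈ D) {X : (Pt 2 → ℂ) → ℂ}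
    (hX : IsDerivationAt p X) {a b : ℂ} (hM : X (frameScale L) = b / 2 * frameScale L p)
    (ha : ∀ i, X (de L i) = a * mlow L i p) (i : Fin 2) :
    X (mup L i) = -(a / L p) * p.2 i - b / 2 * mup L i p := by
  have hne := hL.ne_zero hp
  have hs := hL.contDiffAt_frameScale hp
  have hm := hL.contDiffAt_mup hp
  have h0 := hX.congr ((hL.eventually_mem hp).mono fun q hq => hL.frameScale_mul_mup_zero hq)
  have h1 := hX.congr ((hL.eventually_mem hp).mono fun q hq => hL.frameScale_mul_mup_one hq)
  rw [hX.mul hs (hm _), hM, hX.neg (contDiffAt_de (hL.smoothAt hp) _), ha] at h0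
  rw [hX.mul hs (hm _), hM, ha] at h1
  refine mul_left_cancel₀ (hL.frameScale_ne_zero hp) ?_
  have e0 : mlow L 0 p = -(frameScale L p * p.2 1) / L p :=
    (eq_div_iff hne).2 (by rw [mul_comm, hL.mul_mlow_zero hp])
  have e1 : mlow L 1 p = frameScale L p * p.2 0 / L p :=
    (eq_div_iff hne).2 (by rw [mul_comm, hL.mul_mlow_one hp])
  rw [e1] at h0
  rw [e0] at h1
  fin_cases i
  · simp only [Fin.zero_eta]
    linear_combination h0
  · simp only [Fin.mk_one]
    linear_combination h1

theorem derMbar_mup (hL : IsCFM 2 D L) (hp : p ∈ D) (i : Fin 2) :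
    derMbar L p (mup L i) = -(1 / L p) * p.2 i - conj (sB L p) / 2 * mup L i p :=
  hL.derivation_mup hp (isDerivationAt_derMbar L p) (hL.derMbar_frameScale hp)
    (fun i => by rw [hL.derMbar_de hp, one_mul]) i

theorem derMbar_conj_mup (hL : IsCFM 2 D L) (hp : p ∈ D) (i : Fin 2) :
    derMbar L p (fun q => conj (mup L i q)) =
      -(conj (scaledA L p) / L p) * conj (p.2 i) - conj (sB L p) / 2 * conj (mup L i p) := by
  rw [derMbar_conj L (hL.contDiffAt_mup hp i), hL.derivation_mup hp (isDerivationAt_derM L p)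
    (hL.derM_frameScale hp) (hL.derM_de hp)]
  simp [hL.conj_apply hp, Complex.conj_ofNat]

theorem derMbar_sB (hL : IsCFM 2 D L) (hp : p ∈ D) :
    derMbar L p (sB L) = frameQuartic L p - 3 / 2 * (sB L p * conj (sB L p)) -
      scaledA L p * conj (scaledA L p) / L p := by
  have hX := isDerivationAt_derMbar L p
  have hm := hL.contDiffAt_mup hp
  have hc := fun r => contDiffAt_conj (hm r)
  have hg := hL.contDiffAt_de_gm hp
  rw [hX.congr ((hL.eventually_mem hp).mono fun q hq => hL.sB_eq hq),
    hX.sum _ fun j => ContDiffAt.sum fun k _ => ContDiffAt.sum fun r _ =>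
      (((hm j).mul (hm k)).mul (hc r)).mul (hg j r k)]
  have e : ∀ j, derMbar L p (fun q => ∑ k, ∑ r,
        mup L j q * mup L k q * conj (mup L r q) * de (gm L j r) k q) =
      ∑ k, ∑ r, (((derMbar L p (mup L j) * mup L k p + mup L j p * derMbar L p (mup L k)) *
        conj (mup L r p) + mup L j p * mup L k p * derMbar L p (fun q => conj (mup L r q))) *
        de (gm L j r) k p +
        mup L j p * mup L k p * conj (mup L r p) * derMbar L p (de (gm L j r) k)) := by
    intro j
    rw [hX.sum _ fun k => ContDiffAt.sum fun r _ =>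
      (((hm j).mul (hm k)).mul (hc r)).mul (hg j r k)]
    refine Finset.sum_congr rfl fun k _ => ?_
    rw [hX.sum _ fun r => (((hm j).mul (hm k)).mul (hc r)).mul (hg j r k)]
    refine Finset.sum_congr rfl fun r _ => ?_
    rw [hX.mul (((hm j).mul (hm k)).mul (hc r)) (hg j r k),
      hX.mul ((hm j).mul (hm k)) (hc r), hX.mul (hm j) (hm k)]
  simp only [e, hL.derMbar_mup hp, hL.derMbar_conj_mup hp]
  have h0 : ∀ r k, ∑ i, p.2 i * de (gm L i r) k p = 0 := fun r k => hL.sum_mul_de_gm hp r k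
  have h0' : ∀ j r, ∑ k, p.2 k * de (gm L j r) k p = 0 := fun j r => by
    simp only [hL.de_gm_symm hp j r]; exact h0 r j
  have eB : frameQuartic L p - 3 / 2 * (sB L p * conj (sB L p)) -
      scaledA L p * conj (scaledA L p) / L p =
      frameQuartic L p - 3 / 2 * conj (sB L p) * (∑ j, ∑ k, ∑ r,
        mup L j p * mup L k p * conj (mup L r p) * de (gm L j r) k p) -
      conj (scaledA L p) / L p * (∑ j, ∑ k, ∑ r,
        mup L j p * mup L k p * conj (p.2 r) * de (gm L j r) k p) := by
    rw [← hL.sB_eq hp, ← scaledA]; ring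
  rw [eB, frameQuartic]
  generalize conj (sB L p) = B'
  generalize conj (scaledA L p) = A'
  simp only [Fin.sum_univ_two] at h0 h0' ⊢
  linear_combination
    -(1 / L p) * mup L 0 p * conj (mup L 0 p) * (h0 0 0 + h0' 0 0) -
    (1 / L p) * mup L 0 p * conj (mup L 1 p) * (h0 1 0 + h0' 0 1) -
    (1 / L p) * mup L 1 p * conj (mup L 0 p) * (h0 0 1 + h0' 1 0) -
    (1 / L p) * mup L 1 p * conj (mup L 1 p) * (h0 1 1 + h0' 1 1)

theorem vI_eq (hL : IsCFM 2 D L) (hp : p ∈ D) :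
    vI L p = -frameQuartic L p + sB L p * conj (sB L p) +
      scaledA L p * conj (scaledA L p) / L p := by
  have h : ∑ s, debar (sB L) s p * conj (mup L s p) = derMbar L p (sB L) :=
    Finset.sum_congr rfl fun s _ => mul_comm _ _
  rw [vI, h, hL.derMbar_sB hp]; ring

theorem conj_frameQuartic (hL : IsCFM 2 D L) (hp : p ∈ D) :
    conj (frameQuartic L p) = frameQuartic L p := by
  simp only [frameQuartic, derMbar, Fin.sum_univ_two, map_add, map_mul, Complex.conj_conj,
    hL.conj_debar_de_gm hp]
  ring

theorem conj_vI (hL : IsCFM 2 D L) (hp : p ∈ D) : conj (vI L p) = vI L p := by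
  rw [hL.vI_eq hp]
  simp only [map_add, map_neg, map_mul, map_div₀, Complex.conj_conj, hL.conj_frameQuartic hp,
    hL.conj_apply hp]
  ring

theorem sum_Sv (hL : IsCFM 2 D L) (hp : p ∈ D) :
    ∑ r, ∑ j, ∑ h, ∑ k, Sv L r j h k p * conj (mup L r p) * mup L j p * conj (mup L h p) *
      mup L k p = vI L p := by
  have hX := isDerivationAt_derMbar L p
  have hg := hL.contDiffAt_gm hp
  have hC := hL.contDiffAt_Cc hp
  have hbar : ∀ i r, derMbar L p (gm L i r) = conj (derM L p (gm L r i)) := fun i r => by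
    rw [← derMbar_conj L (hg r i)]
    exact hX.congr ((hL.eventually_mem hp).mono fun q hq => (hL.hermitian q hq r i).symm)
  have hS : ∀ r j k, ∑ h, Sv L r j h k p * conj (mup L h p) =
      ∑ i, derMbar L p (gm L i r) * Cc L i j k p - derMbar L p (de (gm L j r) k) := by
    intro r j k
    rw [← hX.congr ((hL.eventually_mem hp).mono fun q hq => hL.sum_gm_mul_Cc hq r j k),
      hX.sum _ fun i => (hg i r).mul (hC i j k)]
    have e : ∀ i, derMbar L p (fun q => gm L i r q * Cc L i j k q) =
        derMbar L p (gm L i r) * Cc L i j k p + gm L i r p * derMbar L p (Cc L i j k) :=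
      fun i => hX.mul (hg i r) (hC i j k)
    simp only [e, Fin.sum_univ_two]
    simp only [Sv, derMbar, Fin.sum_univ_two]
    ring
  have hAB : ∀ i, ∑ j, ∑ k, mup L j p * mup L k p * Cc L i j k p =
      p.2 i * scaledA L p / L p + mup L i p * sB L p := by
    intro i
    rw [hL.sB_eq hp]
    simp only [Cc, hL.gi_eq hp, scaledA, Fin.sum_univ_two]
    ring
  have hA : ∑ r, ∑ i, conj (mup L r p) * p.2 i * derMbar L p (gm L i r) =
      conj (scaledA L p) := by
    simp only [hbar, derM_gm, scaledA, Fin.sum_univ_two, map_add, map_mul, Complex.conj_conj]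
    ring
  have hB : ∑ r, ∑ i, conj (mup L r p) * mup L i p * derMbar L p (gm L i r) =
      conj (sB L p) := by
    rw [hL.sB_eq hp]
    simp only [hbar, derM_gm, Fin.sum_univ_two, map_add, map_mul, Complex.conj_conj]
    ring
  calc ∑ r, ∑ j, ∑ h, ∑ k, Sv L r j h k p * conj (mup L r p) * mup L j p * conj (mup L h p) *
        mup L k p
      = ∑ r, ∑ j, ∑ k, conj (mup L r p) * mup L j p * mup L k p *
          ∑ h, Sv L r j h k p * conj (mup L h p) := by
        simp only [Fin.sum_univ_two]; ring
    _ = ∑ r, ∑ i, conj (mup L r p) * derMbar L p (gm L i r) *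
          (∑ j, ∑ k, mup L j p * mup L k p * Cc L i j k p) - frameQuartic L p := by
        simp only [hS, frameQuartic, Fin.sum_univ_two]; ring
    _ = (∑ r, ∑ i, conj (mup L r p) * p.2 i * derMbar L p (gm L i r)) * scaledA L p / L p +
          (∑ r, ∑ i, conj (mup L r p) * mup L i p * derMbar L p (gm L i r)) * sB L p -
          frameQuartic L p := by
        simp only [hAB]
        simp only [Fin.sum_univ_two]; ring
    _ = vI L p := by rw [hA, hB, hL.vI_eq hp]; ring

/-- `δ_k L = 0`. -/
theorem sum_Nc_mul_de (hL : IsCFM 2 D L) (hp : p ∈ D) (k : Fin 2) :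
    ∑ j, Nc L j k p * de L j p = dz L k p := by
  have h' : (gmat L p)⁻¹ * gmat L p = 1 :=
    Matrix.nonsing_inv_mul _ (isUnit_iff_ne_zero.2 (hL.det_ne_zero hp))
  have hg : ∀ m, ∑ j, gi L m j p * de L j p = conj (p.2 m) := fun m => by
    have e : ∀ r, ∑ j, gi L m j p * gm L j r p = if m = r then 1 else 0 := fun r => by
      rw [← Matrix.one_apply, ← h', Matrix.mul_apply]; rfl
    simp only [← hL.sum_gm_mul_conj hp, Finset.mul_sum]
    rw [Finset.sum_comm]
    simp only [← mul_assoc, ← Finset.sum_mul, e]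
    simp
  rw [← hL.sum_dz_gm hp k]
  simp only [← hg, Nc, Fin.sum_univ_two]
  ring

end IsCFM

/-- if `A, B` are nowhere zero, `δ_k I = 0` and `∂I/∂η^i = −(I/F) l_i`
on connected `D`, then `I·L` is a real constant `c` and the vertical holomorphic
sectional curvature in direction `m` is `2c/L`. -/
theorem statement9 (D : Set (Pt 2)) (L : Pt 2 → ℂ) (hL : IsCFM 2 D L)
    (hconn : IsConnected D)
    (hA : ∀ p ∈ D, sA L p ≠ 0) (hB : ∀ p ∈ D, sB L p ≠ 0)
    (hI1 : ∀ p ∈ D, ∀ k, del L (vI L) k p = 0)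
    (hI2 : ∀ p ∈ D, ∀ i, de (vI L) i p = -(vI L p / Fh L p) * llow L i p) :
    ∃ c : ℝ, ∀ p ∈ D, vI L p * L p = (c : ℂ) ∧ vI L p = (c : ℂ) / L p ∧
      2 * (∑ r, ∑ j, ∑ h, ∑ k, Sv L r j h k p * (starRingEnd ℂ) (mup L r p) *
        mup L j p * (starRingEnd ℂ) (mup L h p) * mup L k p) = 2 * (c : ℂ) / L p := by
  have hderiv : ∀ p ∈ D, fderiv ℝ (fun q => vI L q * L q) p = 0 := by
    intro p hp
    have hI := hL.contDiffAt_vI hp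
    have hLp := hL.smoothAt hp
    have hf : ContDiffAt ℝ ∞ (fun q => vI L q * L q) p := hI.mul hLp
    have hreal : (fun q => conj (vI L q * L q)) =ᶠ[𝓝 p] fun q => vI L q * L q :=
      (hL.eventually_mem hp).mono fun q hq => by
        simp only [map_mul, hL.conj_vI hq, hL.conj_apply hq]
    have h3 : ∀ k, de (fun q => vI L q * L q) k p = 0 := fun k => by
      rw [(isDerivationAt_de k p).mul hI hLp, hI2 p hp k, ← hL.llow_mul_Fh hp k, ← hL.Fh_sq hp]
      field_simp [hL.Fh_ne_zero hp]
      ring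
    have h1 : ∀ k, dz (fun q => vI L q * L q) k p = 0 := fun k => by
      have h := hI1 p hp k
      rw [del, sub_eq_zero] at h
      have e := fun j => (isDerivationAt_de j p).mul hI hLp
      simp only [h3] at e
      rw [(isDerivationAt_dz k p).mul hI hLp, h, ← hL.sum_Nc_mul_de hp k, Finset.sum_mul,
        Finset.mul_sum, ← Finset.sum_add_distrib]
      exact Finset.sum_eq_zero fun j _ => by linear_combination -Nc L j k p * e j
    refine fderiv_eq_zero_of_wirtinger h1 (fun k => ?_) h3 (fun k => ?_)
    · rw [dzbar_eq, ← (isDerivationAt_wirt _ _ _ p).congr hreal, ← dzbar_eq, dzbar_conj hf, h1,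
        map_zero]
    · rw [← (isDerivationAt_debar k p).congr hreal, debar_conj hf, h3, map_zero]
  obtain ⟨c, hc⟩ := hL.openD.exists_is_const_of_fderiv_eq_zero (𝕜 := ℝ) hconn.isPreconnected
    (fun p hp => (((hL.contDiffAt_vI hp).mul (hL.smoothAt hp)).differentiableAt
      (by simp)).differentiableWithinAt) hderiv
  obtain ⟨p₀, hp₀⟩ := hconn.nonempty
  have hcre : ((c.re : ℝ) : ℂ) = c := by
    rw [← Complex.conj_eq_iff_re, ← hc p₀ hp₀, map_mul, hL.conj_vI hp₀, hL.conj_apply hp₀]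
  refine ⟨c.re, fun p hp => ?_⟩
  have hIp : vI L p = c / L p := (eq_div_iff (hL.ne_zero hp)).2 (hc p hp)
  rw [hcre]
  refine ⟨hc p hp, hIp, ?_⟩
  rw [hL.sum_Sv hp, hIp]
  ring

end CFinsler
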